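/- Let d be a positive even integer and let Λ_{2d} = ℤL ⊕ E8(−2), where L·L = 2d and L is orthogonal to E8(−2). Then there exists an even overlattice Λ̃ of Λ_{2d} with [Λ̃ : Λ_{2d}] = 2 in which both ℤL and E8(−2) are primitive sublattices; such a Λ̃ is generated over Λ_{2d} by (L + v)/2 for a suitable v ∈ E8(−2), where v·v ≡ 4 mod 8 if d ≡ 2 mod 4 and v·v ≡ 0 mod 8 if d ≡ 0 mod 4. -/

import Mathlib

open Matrix Finset

/-- The ambient space `Λ_{2d} ⊗ ℚ = ℚL ⊕ (E8(-2) ⊗ ℚ)`. -/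
abbrev Amb : Type := ℚ × (Fin 8 → ℚ)

/-- The E8 Cartan matrix over `ℚ`. -/
def E8Q : Matrix (Fin 8) (Fin 8) ℚ := CartanMatrix.E₈.map fun k => (k : ℚ)

/-- The bilinear form of `ℤL ⊕ E8(-2)` (extended to the ambient `ℚ`-space), where
`L·L = 2d` and the second factor carries `-2` times the E8 Cartan pairing. -/
def bL (d : ℤ) (p q : Amb) : ℚ := 2 * d * p.1 * q.1 + (-2) * (p.2 ⬝ᵥ (E8Q *ᵥ q.2))

/-- The integers inside `ℚ` (the coefficients of `L`). -/
def Zsub : Submodule ℤ ℚ := Submodule.span ℤ ({1} : Set ℚ)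

/-- The integral points of `E8(-2) ⊗ ℚ`. -/
def ZV : Submodule ℤ (Fin 8 → ℚ) :=
  Submodule.span ℤ (Set.range fun i => Pi.single i (1 : ℚ))

/-- The lattice `Λ_{2d} = ℤL ⊕ E8(-2)`. -/
def Lambda : Submodule ℤ Amb := Zsub.prod ZV

/-- The sublattice `ℤL`. -/
def Lline : Submodule ℤ Amb := Zsub.prod ⊥

/-- The sublattice `E8(-2)`. -/
def Esub : Submodule ℤ Amb := (⊥ : Submodule ℤ ℚ).prod ZV

/-- The value `v·v` in `E8(-2)` for an integral vector `v`. -/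
def q8 (v : Fin 8 → ℤ) : ℤ := -2 * (v ⬝ᵥ (CartanMatrix.E₈ *ᵥ v))

/-- The conditions on an even overlattice `Λ'` of `Λ_{2d}` of index `2` in which both
`ℤL` and `E8(-2)` are primitive sublattices. -/
def GoodOverlattice (d : ℤ) (Λ' : Submodule ℤ Amb) : Prop :=
  Lambda ≤ Λ' ∧
  (∀ x ∈ Λ', ∀ y ∈ Λ', ∃ k : ℤ, bL d x y = k) ∧
  (∀ x ∈ Λ', ∃ k : ℤ, bL d x x = 2 * k) ∧
  Nat.card (Λ' ⧸ Lambda.comap Λ'.subtype) = 2 ∧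
  (∀ x ∈ Λ', ∀ n : ℤ, n ≠ 0 → n • x ∈ Lline → x ∈ Lline) ∧
  (∀ x ∈ Λ', ∀ n : ℤ, n ≠ 0 → n • x ∈ Esub → x ∈ Esub)

theorem mem_Zsub_iff {x : ℚ} : x ∈ Zsub ↔ ∃ a : ℤ, (a : ℚ) = x := by
  simp [Zsub, Submodule.mem_span_singleton]

theorem mem_ZV_iff {x : Fin 8 → ℚ} : x ∈ ZV ↔ ∃ u : Fin 8 → ℤ, (fun i => (u i : ℚ)) = x := by
  rw [ZV, Submodule.mem_span_range_iff_exists_fun]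
  refine exists_congr fun u => Eq.congr_left ?_
  ext j
  simp [Finset.sum_apply, Pi.single_apply]

theorem mem_Lambda_iff {x : Amb} :
    x ∈ Lambda ↔ ∃ (a : ℤ) (u : Fin 8 → ℤ), x = ((a : ℚ), fun i => (u i : ℚ)) := by
  rw [Lambda, Submodule.mem_prod, mem_Zsub_iff, mem_ZV_iff]
  constructor
  · rintro ⟨⟨a, ha⟩, u, hu⟩
    exact ⟨a, u, Prod.ext ha.symm hu.symm⟩
  · rintro ⟨a, u, rfl⟩
    exact ⟨⟨a, rfl⟩, u, rfl⟩

/-- The E8 pairing of integral vectors. -/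
def e8Pairing (u v : Fin 8 → ℤ) : ℤ := u ⬝ᵥ (CartanMatrix.E₈ *ᵥ v)

theorem e8Pairing_comm (u v : Fin 8 → ℤ) : e8Pairing u v = e8Pairing v u := by
  have h : CartanMatrix.E₈ᵀ = CartanMatrix.E₈ := by decide
  rw [e8Pairing, e8Pairing, dotProduct_mulVec, ← mulVec_transpose, h, dotProduct_comm]

theorem e8Pairing_two_mul_add (k l : ℤ) (s t v : Fin 8 → ℤ) :
    e8Pairing (2 • s + k • v) (2 • t + l • v) =
      4 * e8Pairing s t + 2 * l * e8Pairing s v + 2 * k * e8Pairing t v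
        + k * l * e8Pairing v v := by
  have h := e8Pairing_comm v t
  simp only [e8Pairing] at h ⊢
  simp only [mulVec_add, mulVec_smul, dotProduct_add, add_dotProduct, smul_dotProduct,
    dotProduct_smul, h, smul_eq_mul]
  ring

theorem bL_half (d a b : ℤ) (s t : Fin 8 → ℤ) :
    bL d ((a : ℚ) / 2, fun i => (s i : ℚ) / 2) ((b : ℚ) / 2, fun i => (t i : ℚ) / 2) =
      ((d * a * b - e8Pairing s t : ℤ) : ℚ) / 2 := by
  have h : ∀ u : Fin 8 → ℤ,
      (fun i => (u i : ℚ) / 2) = (1 / 2 : ℚ) • fun i => (u i : ℚ) := fun u => by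
    ext i; simp; ring
  have h2 : (fun i => (s i : ℚ)) ⬝ᵥ (E8Q *ᵥ fun i => (t i : ℚ)) = (e8Pairing s t : ℚ) := by
    simp [e8Pairing, E8Q, dotProduct, mulVec]
  rw [bL, h, h, mulVec_smul, dotProduct_smul, smul_dotProduct, h2]
  simp only [smul_eq_mul]
  push_cast
  ring

/-- The lattice generated over `Λ_{2d}` by `(L + v)/2`. -/
def halfGlue (v : Fin 8 → ℤ) : Submodule ℤ Amb :=
  Lambda ⊔ Submodule.span ℤ ({((1 : ℚ) / 2, fun i => (v i : ℚ) / 2)} : Set Amb)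

theorem mem_halfGlue_iff {v : Fin 8 → ℤ} {x : Amb} :
    x ∈ halfGlue v ↔ ∃ (a k : ℤ) (u : Fin 8 → ℤ),
      x = (((2 * a + k : ℤ) : ℚ) / 2, fun i => (((2 • u + k • v) i : ℤ) : ℚ) / 2) := by
  have key : ∀ (a k : ℤ) (u : Fin 8 → ℤ),
      (((a : ℚ), fun i => (u i : ℚ)) : Amb) + k • ((1 : ℚ) / 2, fun i => (v i : ℚ) / 2) =
      (((2 * a + k : ℤ) : ℚ) / 2, fun i => (((2 • u + k • v) i : ℤ) : ℚ) / 2) := by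
    intro a k u
    refine Prod.ext ?_ (funext fun i => ?_)
    · simp; ring
    · simp; ring
  simp only [halfGlue, Submodule.mem_sup, mem_Lambda_iff, Submodule.mem_span_singleton]
  constructor
  · rintro ⟨_, ⟨a, u, rfl⟩, _, ⟨k, rfl⟩, rfl⟩
    exact ⟨a, k, u, key a k u⟩
  · rintro ⟨a, k, u, rfl⟩
    exact ⟨_, ⟨a, u, rfl⟩, _, ⟨k, rfl⟩, key a k u⟩

theorem card_quotient_comap_eq_two_iff (Λ' : Submodule ℤ Amb) :
    Nat.card (Λ' ⧸ Lambda.comap Λ'.subtype) = 2 ↔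
      ∃ a ∈ Λ', a ∉ Lambda ∧ ∀ b ∈ Λ', b + a ∈ Lambda ∨ b ∈ Lambda := by
  have h := AddSubgroup.index_eq_two_iff_exists_notMem_and
    (H := (Lambda.comap Λ'.subtype).toAddSubgroup)
  have h2 : Nat.card (Λ' ⧸ Lambda.comap Λ'.subtype) =
    (Lambda.comap Λ'.subtype).toAddSubgroup.index := rfl
  rw [h2, h]
  simp [and_left_comm]

theorem goodOverlattice_halfGlue {e m : ℤ} {v : Fin 8 → ℤ} (hv : e8Pairing v v = 2 * m)
    (hem : Even (e - m)) {j : Fin 8} (hj : Odd (v j)) :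
    GoodOverlattice (2 * e) (halfGlue v) := by
  refine ⟨le_sup_left, ?_, ?_, ?_, ?_, ?_⟩
  · intro x hx y hy
    obtain ⟨a, k, s, rfl⟩ := mem_halfGlue_iff.1 hx
    obtain ⟨b, l, t, rfl⟩ := mem_halfGlue_iff.1 hy
    refine ⟨e * (2 * a + k) * (2 * b + l) -
      (2 * e8Pairing s t + l * e8Pairing s v + k * e8Pairing t v + k * l * m), ?_⟩
    rw [bL_half, e8Pairing_two_mul_add, hv]
    push_cast
    ring
  · intro x hx
    obtain ⟨a, k, s, rfl⟩ := mem_halfGlue_iff.1 hx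
    obtain ⟨c, hc⟩ := hem
    obtain rfl : e = m + 2 * c := by linarith
    refine ⟨2 * (m + 2 * c) * (a * a + a * k) + c * k * k -
      (e8Pairing s s + k * e8Pairing s v), ?_⟩
    rw [bL_half, e8Pairing_two_mul_add, hv]
    push_cast
    ring
  · rw [card_quotient_comap_eq_two_iff]
    have h_iff : ∀ (a k : ℤ) (s : Fin 8 → ℤ),
        ((((2 * a + k : ℤ) : ℚ) / 2, fun i => (((2 • s + k • v) i : ℤ) : ℚ) / 2) : Amb)
          ∈ Lambda ↔ Even k := by
      intro a k s
      rw [mem_Lambda_iff]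
      constructor
      · rintro ⟨b, u, h⟩
        have h1 := congrArg Prod.fst h
        simp only at h1
        have h2 : 2 * a + k = 2 * b := by
          have : ((2 * a + k : ℤ) : ℚ) = ((2 * b : ℤ) : ℚ) := by
            push_cast at h1 ⊢; linarith
          exact_mod_cast this
        exact ⟨b - a, by linarith⟩
      · rintro ⟨c, rfl⟩
        refine ⟨a + c, s + c • v, Prod.ext ?_ (funext fun i => ?_)⟩
        · simp; ring
        · simp; ring
    refine ⟨_, mem_halfGlue_iff.2 ⟨0, 1, 0, rfl⟩, by rw [h_iff]; decide, fun x hx => ?_⟩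
    obtain ⟨a, k, s, rfl⟩ := mem_halfGlue_iff.1 hx
    have h_add : ((((2 * a + k : ℤ) : ℚ) / 2, fun i => (((2 • s + k • v) i : ℤ) : ℚ) / 2) : Amb)
        + (((2 * 0 + 1 : ℤ) : ℚ) / 2,
          fun i => (((2 • (0 : Fin 8 → ℤ) + (1 : ℤ) • v) i : ℤ) : ℚ) / 2) =
        (((2 * a + (k + 1) : ℤ) : ℚ) / 2,
          fun i => (((2 • s + (k + 1) • v) i : ℤ) : ℚ) / 2) := by
      refine Prod.ext ?_ (funext fun i => ?_)
      · simp; ring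
      · simp; ring
    rw [h_add, h_iff, h_iff, Int.even_add_one]
    exact (em _).symm
  · intro x hx n hn h
    obtain ⟨a, k, s, rfl⟩ := mem_halfGlue_iff.1 hx
    rw [Lline, Submodule.mem_prod, Submodule.mem_bot] at h ⊢
    have h0 := (smul_eq_zero.1 h.2).resolve_left hn
    refine ⟨mem_Zsub_iff.2 ?_, h0⟩
    have hk : 2 * s j + k * v j = 0 := by
      have := congrFun h0 j
      simp only [Pi.add_apply, Pi.smul_apply, Pi.zero_apply, smul_eq_mul, div_eq_zero_iff,
        Int.cast_eq_zero, OfNat.ofNat_ne_zero, or_false, nsmul_eq_mul] at this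
      exact_mod_cast this
    have hk2 : Even k := by
      have : Even (k * v j) := ⟨-s j, by linarith⟩
      exact (Int.even_mul.1 this).resolve_right (Int.not_even_iff_odd.2 hj)
    obtain ⟨c, rfl⟩ := hk2
    exact ⟨a + c, by push_cast; ring⟩
  · intro x hx n hn h
    obtain ⟨a, k, s, rfl⟩ := mem_halfGlue_iff.1 hx
    rw [Esub, Submodule.mem_prod, Submodule.mem_bot] at h ⊢
    have h0 := (smul_eq_zero.1 h.1).resolve_left hn
    refine ⟨h0, mem_ZV_iff.2 ⟨s - a • v, funext fun i => ?_⟩⟩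
    have hk : 2 * a + k = 0 := by
      simp only [div_eq_zero_iff, Int.cast_eq_zero] at h0
      simpa using h0
    obtain rfl : k = -2 * a := by linarith
    simp
    ring

theorem GoodOverlattice.exists_eq_halfGlue {d : ℤ} {Λ' : Submodule ℤ Amb}
    (h : GoodOverlattice d Λ') : ∃ v : Fin 8 → ℤ, Λ' = halfGlue v := by
  obtain ⟨hle, -, -, hcard, -, hE⟩ := h
  obtain ⟨x, hx, hx_not, hadd⟩ := (card_quotient_comap_eq_two_iff Λ').1 hcard
  have hxx : x + x ∈ Lambda := (hadd x hx).resolve_right hx_not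
  obtain ⟨a, v, hav⟩ := mem_Lambda_iff.1 hxx
  have hx1 : x = ((a : ℚ) / 2, fun i => (v i : ℚ) / 2) := by
    refine Prod.ext ?_ (funext fun i => ?_)
    · have := congrArg Prod.fst hav
      simp at this ⊢
      linarith
    · have := congrFun (congrArg Prod.snd hav) i
      simp at this ⊢
      linarith
  have hint : ∀ c : ℤ, ((c : ℚ), (0 : Fin 8 → ℚ)) ∈ Lambda := fun c =>
    mem_Lambda_iff.2 ⟨c, 0, Prod.ext rfl (by ext; simp)⟩
  obtain ⟨c, rfl⟩ | ⟨c, rfl⟩ := Int.even_or_odd a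
  · exfalso
    apply hx_not
    have hy : x - ((c : ℚ), (0 : Fin 8 → ℚ)) ∈ Λ' := Λ'.sub_mem hx (hle (hint c))
    have hyE : x - ((c : ℚ), (0 : Fin 8 → ℚ)) ∈ Esub := by
      refine hE _ hy 2 two_ne_zero ?_
      rw [Esub, Submodule.mem_prod, Submodule.mem_bot, mem_ZV_iff]
      refine ⟨?_, v, ?_⟩
      · simp [hx1]
      · ext i
        simp [hx1]
        ring
    have hyL : x - ((c : ℚ), (0 : Fin 8 → ℚ)) ∈ Lambda :=
      Submodule.prod_mono bot_le le_rfl hyE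
    simpa using Lambda.add_mem hyL (hint c)
  · refine ⟨v, ?_⟩
    have hw : (((1 : ℚ) / 2, fun i => (v i : ℚ) / 2) : Amb) = x - ((c : ℚ), (0 : Fin 8 → ℚ)) := by
      refine Prod.ext ?_ (funext fun i => ?_)
      · simp [hx1]; ring
      · simp [hx1]
    apply le_antisymm
    · intro y hy
      by_cases hyL : y ∈ Lambda
      · exact Submodule.mem_sup_left hyL
      · have hyx : y + x ∈ Lambda := (hadd y hy).resolve_right hyL
        refine Submodule.mem_sup.2 ⟨y + x - (x + x) + ((c : ℚ), (0 : Fin 8 → ℚ)), ?_, _,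
          Submodule.mem_span_singleton_self _, ?_⟩
        · exact Lambda.add_mem (Lambda.sub_mem hyx hxx) (hint c)
        · rw [hw]; abel
    · refine sup_le hle ?_
      rw [Submodule.span_singleton_le_iff_mem, hw]
      exact Λ'.sub_mem hx (hle (hint c))

theorem exists_q8_eq_of_even {d : ℤ} {v : Fin 8 → ℤ}
    (h : ∀ x ∈ halfGlue v, ∃ k : ℤ, bL d x x = 2 * k) : ∃ k : ℤ, q8 v = 8 * k - 2 * d := by
  obtain ⟨k, hk⟩ := h _ (Submodule.mem_sup_right (Submodule.mem_span_singleton_self _))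
  have hb := bL_half d 1 1 v v
  rw [Int.cast_one, hk] at hb
  refine ⟨k, ?_⟩
  have hq : q8 v = -2 * e8Pairing v v := rfl
  have : (4 * k : ℤ) = d * 1 * 1 - e8Pairing v v := by
    have : ((4 * k : ℤ) : ℚ) = ((d * 1 * 1 - e8Pairing v v : ℤ) : ℚ) := by
      push_cast at hb ⊢; linarith
    exact_mod_cast this
  linarith

theorem exists_goodOverlattice_two_mul (e : ℤ) : ∃ Λ', GoodOverlattice (2 * e) Λ' := by
  obtain h | h := Int.even_or_odd e
  · exact ⟨_, goodOverlattice_halfGlue (m := 2) (v := ![1, 1, 0, 0, 0, 0, 0, 0]) (j := 0)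
      (by decide) (by grind) (by decide)⟩
  · exact ⟨_, goodOverlattice_halfGlue (m := 1) (v := ![1, 0, 0, 0, 0, 0, 0, 0]) (j := 0)
      (by decide) (by grind) (by decide)⟩

/-- for `d` even there exists an even overlattice of `Λ_{2d}` of index `2`
in which both `ℤL` and `E8(-2)` are primitive, and any such overlattice is generated over
`Λ_{2d}` by `(L + v)/2` for a suitable `v ∈ E8(-2)` with `v·v ≡ 4 mod 8` if `d ≡ 2 mod 4`
and `v·v ≡ 0 mod 8` if `d ≡ 0 mod 4`. -/
theorem index_two_even_overlattice_of_even_d (d : ℤ) (hd : 0 < d) (he : Even d) :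
    (∃ Λ' : Submodule ℤ Amb, GoodOverlattice d Λ') ∧
    (∀ Λ' : Submodule ℤ Amb, GoodOverlattice d Λ' →
      ∃ v : Fin 8 → ℤ,
        (d ≡ 2 [ZMOD 4] → q8 v ≡ 4 [ZMOD 8]) ∧
        (d ≡ 0 [ZMOD 4] → q8 v ≡ 0 [ZMOD 8]) ∧
        Λ' = Lambda ⊔ Submodule.span ℤ
          ({((1 : ℚ) / 2, fun i => (v i : ℚ) / 2)} : Set Amb)) := by
  refine ⟨?_, fun Λ' h => ?_⟩
  · obtain ⟨e, rfl⟩ := he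
    rw [← two_mul]
    exact exists_goodOverlattice_two_mul e
  · obtain ⟨v, rfl⟩ := h.exists_eq_halfGlue
    obtain ⟨k, hk⟩ := exists_q8_eq_of_even h.2.2.1
    refine ⟨v, fun hd4 => ?_, fun hd4 => ?_, rfl⟩ <;>
      simp only [Int.ModEq] at hd4 ⊢ <;> omega
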